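/- For elements z_1,…,z_6 with coordinates z_i = (x_i, y_i) in a ℚ-algebra, the determinant of the 6×6 matrix with i-th row (1, x_i, x_i², y_i, x_i y_i, x_i² y_i) equals (1/144)·∑_{σ∈S_6} sign(σ)·V(x_{σ(1)},x_{σ(2)},x_{σ(3)})·V(x_{σ(4)},x_{σ(5)},x_{σ(6)})·(y_{σ(4)}−y_{σ(1)})(y_{σ(5)}−y_{σ(2)})(y_{σ(6)}−y_{σ(3)}), where V(a,b,c) = (b−a)(c−b)(c−a). -/

import Mathlib

/-- The signed sum `∑ σ, sign σ * f σ` over all permutations, as a linear functional of `f`. -/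
def signedSum (ι R : Type*) [Fintype ι] [DecidableEq ι] [CommRing R] :
    (Equiv.Perm ι → R) →ₗ[R] R where
  toFun f := ∑ σ, ((Equiv.Perm.sign σ : ℤ) : R) * f σ
  map_add' f g := by simp [mul_add, Finset.sum_add_distrib]
  map_smul' a f := by simp [Finset.mul_sum, mul_left_comm]

section SignedSum

open Equiv Equiv.Perm

variable {ι R : Type*} [Fintype ι] [DecidableEq ι] [CommRing R]

theorem signedSum_apply (f : Perm ι → R) :
    signedSum ι R f = ∑ σ, ((sign σ : ℤ) : R) * f σ := rfl

theorem signedSum_mul_right (π : Perm ι) (f : Perm ι → R) :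
    signedSum ι R (fun σ => f (σ * π)) = ((sign π : ℤ) : R) * signedSum ι R f := by
  simp only [signedSum_apply, Finset.mul_sum]
  refine Fintype.sum_equiv (Equiv.mulRight π) _ _ fun σ => ?_
  have h : ((sign π : ℤ) : R) * ((sign π : ℤ) : R) = 1 := by
    rcases Int.units_eq_one_or (sign π) with h | h <;> simp [h]
  simp only [Equiv.coe_mulRight, Perm.sign_mul, Units.val_mul, Int.cast_mul]
  linear_combination (-((sign σ : ℤ) : R) * f (σ * π)) * h

theorem signedSum_mul_swap {i j : ι} (hij : i ≠ j) (f : Perm ι → R) :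
    signedSum ι R (fun σ => f (σ * swap i j)) = -signedSum ι R f := by
  simp [signedSum_mul_right, sign_swap hij]

theorem signedSum_prod (M : Matrix ι ι R) (c : ι → ι) :
    signedSum ι R (fun σ => ∏ i, M (σ i) (c i)) = (M.submatrix id c).det := by
  simp [signedSum_apply, Matrix.det_apply']

/-- Against a factor symmetric in the places `i` and `j`, the Vandermonde product may be replaced
by twice the sum of its even monomials. -/
theorem signedSum_vandermonde_mul {i j k : ι} (hij : i ≠ j) (hik : i ≠ k) (hjk : j ≠ k)
    (x : ι → R) (f : Perm ι → R) (hf : ∀ σ, f (σ * swap i j) = f σ) :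
    signedSum ι R (fun σ => (x (σ j) - x (σ i)) * (x (σ k) - x (σ j)) * (x (σ k) - x (σ i)) * f σ) =
      2 * signedSum ι R (fun σ => (x (σ j) * x (σ k) ^ 2 + x (σ k) * x (σ i) ^ 2 +
        x (σ i) * x (σ j) ^ 2) * f σ) := by
  set g : Perm ι → R := fun σ => (x (σ j) * x (σ k) ^ 2 + x (σ k) * x (σ i) ^ 2 +
        x (σ i) * x (σ j) ^ 2) * f σ with hg
  have key : (fun σ : Perm ι => (x (σ j) - x (σ i)) * (x (σ k) - x (σ j)) * (x (σ k) - x (σ i)) *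
      f σ) = g - fun σ => g (σ * swap i j) := by
    ext σ
    simp only [hg, Pi.sub_apply, hf, Perm.mul_apply, swap_apply_left, swap_apply_right,
      swap_apply_of_ne_of_ne hik.symm hjk.symm]
    ring
  rw [key, map_sub, signedSum_mul_swap hij]
  ring

/-- Against a factor symmetric in the places `i`, `j`, `k`, the Vandermonde product may be replaced
by six times its leading monomial. -/
theorem signedSum_vandermonde_mul_of_symm {i j k : ι} (hij : i ≠ j) (hik : i ≠ k) (hjk : j ≠ k)
    (x : ι → R) (f : Perm ι → R) (hf : ∀ σ, f (σ * swap i j) = f σ)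
    (hf' : ∀ σ, f (σ * swap j k) = f σ) :
    signedSum ι R (fun σ => (x (σ j) - x (σ i)) * (x (σ k) - x (σ j)) * (x (σ k) - x (σ i)) * f σ) =
      6 * signedSum ι R (fun σ => x (σ j) * x (σ k) ^ 2 * f σ) := by
  rw [signedSum_vandermonde_mul hij hik hjk x f hf]
  set g : Perm ι → R := fun σ => x (σ j) * x (σ k) ^ 2 * f σ with hg
  have key : (fun σ : Perm ι => (x (σ j) * x (σ k) ^ 2 + x (σ k) * x (σ i) ^ 2 +
      x (σ i) * x (σ j) ^ 2) * f σ) = g + (fun σ => g (σ * (swap i j * swap j k))) +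
        fun σ => g (σ * (swap j k * swap i j)) := by
    ext σ
    simp only [hg, Pi.add_apply, ← mul_assoc, hf, hf', Perm.mul_apply, swap_apply_left,
      swap_apply_right, swap_apply_of_ne_of_ne hik.symm hjk.symm, swap_apply_of_ne_of_ne hij hik]
    ring
  rw [key, map_add, map_add, signedSum_mul_right, signedSum_mul_right]
  simp only [Perm.sign_mul, sign_swap hij, sign_swap hjk]
  push_cast
  ring

end SignedSum

section VandermondeThreeTwo

open Equiv Equiv.Perm

variable {R : Type*} [CommRing R] (x y : Fin 6 → R)

/-- The multivariable Vandermonde matrix with rows `1, x, x², y, x y, x² y`. -/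
def vandermondeThreeTwo : Matrix (Fin 6) (Fin 6) R :=
  Matrix.of fun i j => ![1, x i, x i ^ 2, y i, x i * y i, x i ^ 2 * y i] j

theorem signedSum_vandermonde_mul_vandermonde_separated :
    signedSum (Fin 6) R (fun σ =>
      (x (σ 1) - x (σ 0)) * (x (σ 2) - x (σ 1)) * (x (σ 2) - x (σ 0)) *
        ((x (σ 4) - x (σ 3)) * (x (σ 5) - x (σ 4)) * (x (σ 5) - x (σ 3)) *
          (y (σ 3) * y (σ 4) * y (σ 5)))) = 36 * (vandermondeThreeTwo x y).det := by
  have h₁ := signedSum_vandermonde_mul_of_symm (i := (0 : Fin 6)) (j := 1) (k := 2) (by decide)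
    (by decide) (by decide) x
    (fun σ => (x (σ 4) - x (σ 3)) * (x (σ 5) - x (σ 4)) * (x (σ 5) - x (σ 3)) *
      (y (σ 3) * y (σ 4) * y (σ 5)))
    (by intro σ; simp [Perm.mul_apply, swap_apply_def])
    (by intro σ; simp [Perm.mul_apply, swap_apply_def])
  have h₂ := signedSum_vandermonde_mul_of_symm (i := (3 : Fin 6)) (j := 4) (k := 5) (by decide)
    (by decide) (by decide) x
    (fun σ => x (σ 1) * x (σ 2) ^ 2 * (y (σ 3) * y (σ 4) * y (σ 5)))
    (by intro σ; simp [Perm.mul_apply, swap_apply_def]; ring)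
    (by intro σ; simp [Perm.mul_apply, swap_apply_def]; ring)
  have hdet := signedSum_prod (vandermondeThreeTwo x y) id
  rw [Matrix.submatrix_id_id] at hdet
  rw [h₁, (congrArg _ (funext fun σ => mul_left_comm _ _ _)).trans h₂, ← hdet, ← mul_assoc]
  norm_num only
  congr 2
  ext σ
  simp [vandermondeThreeTwo, Fin.prod_univ_six]
  ring

theorem signedSum_vandermonde_mul_vandermonde_mixed :
    signedSum (Fin 6) R (fun σ =>
      (x (σ 1) - x (σ 0)) * (x (σ 2) - x (σ 1)) * (x (σ 2) - x (σ 0)) *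
        ((x (σ 4) - x (σ 3)) * (x (σ 5) - x (σ 4)) * (x (σ 5) - x (σ 3)) *
          (y (σ 2) * y (σ 3) * y (σ 4)))) = -12 * (vandermondeThreeTwo x y).det := by
  have h₁ := signedSum_vandermonde_mul (i := (0 : Fin 6)) (j := 1) (k := 2) (by decide)
    (by decide) (by decide) x
    (fun σ => (x (σ 4) - x (σ 3)) * (x (σ 5) - x (σ 4)) * (x (σ 5) - x (σ 3)) *
      (y (σ 2) * y (σ 3) * y (σ 4)))
    (by intro σ; simp [Perm.mul_apply, swap_apply_def])
  have h₂ := signedSum_vandermonde_mul (i := (3 : Fin 6)) (j := 4) (k := 5) (by decide)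
    (by decide) (by decide) x
    (fun σ => (x (σ 1) * x (σ 2) ^ 2 + x (σ 2) * x (σ 0) ^ 2 + x (σ 0) * x (σ 1) ^ 2) *
      (y (σ 2) * y (σ 3) * y (σ 4)))
    (by intro σ; simp [Perm.mul_apply, swap_apply_def]; ring)
  rw [h₁, (congrArg _ (funext fun σ => mul_left_comm _ _ _)).trans h₂]
  let m (c : Fin 6 → Fin 6) (σ : Perm (Fin 6)) : R := ∏ i, vandermondeThreeTwo x y (σ i) (c i)
  have key : (fun σ : Perm (Fin 6) =>
      (x (σ 4) * x (σ 5) ^ 2 + x (σ 5) * x (σ 3) ^ 2 + x (σ 3) * x (σ 4) ^ 2) *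
        ((x (σ 1) * x (σ 2) ^ 2 + x (σ 2) * x (σ 0) ^ 2 + x (σ 0) * x (σ 1) ^ 2) *
          (y (σ 2) * y (σ 3) * y (σ 4)))) =
      m ![0, 1, 5, 3, 4, 2] + m ![0, 1, 5, 5, 3, 1] + m ![0, 1, 5, 4, 5, 0] +
      m ![2, 0, 4, 3, 4, 2] + m ![2, 0, 4, 5, 3, 1] + m ![2, 0, 4, 4, 5, 0] +
      m ![1, 2, 3, 3, 4, 2] + m ![1, 2, 3, 5, 3, 1] + m ![1, 2, 3, 4, 5, 0] := by
    ext σ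
    simp [m, vandermondeThreeTwo, Fin.prod_univ_six]
    ring
  have hm (c : Fin 6 → Fin 6) :
      signedSum (Fin 6) R (m c) = ((vandermondeThreeTwo x y).submatrix id c).det :=
    signedSum_prod _ c
  have hzero {c : Fin 6 → Fin 6} (i j : Fin 6) (hij : i ≠ j) (hc : c i = c j) :
      signedSum (Fin 6) R (m c) = 0 := by
    rw [hm]
    exact Matrix.det_zero_of_column_eq hij fun k => by simp [hc]
  have hperm {c : Fin 6 → Fin 6} (π : Perm (Fin 6)) (hc : c = π) (hπ : sign π = -1) :
      signedSum (Fin 6) R (m c) = -(vandermondeThreeTwo x y).det := by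
    rw [hm, hc, Matrix.det_permute', hπ]
    simp
  rw [key]
  simp only [map_add]
  rw [hperm (swap 2 5) (by decide) (by decide), hzero 1 5 (by decide) rfl,
    hzero 0 5 (by decide) rfl, hzero 0 5 (by decide) rfl,
    hperm (c[0, 2, 4, 3, 5, 1]) (by decide) (by decide), hzero 1 5 (by decide) rfl,
    hzero 1 5 (by decide) rfl, hzero 0 5 (by decide) rfl,
    hperm (c[0, 1, 2, 3, 4, 5]) (by decide) (by decide)]
  ring

end VandermondeThreeTwo

theorem stmt_13 {F : Type*} [Field F] [CharZero F] (x y : Fin 6 → F) :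
    (Matrix.of fun i j => ![1, x i, x i ^ 2, y i, x i * y i, x i ^ 2 * y i] j :
        Matrix (Fin 6) (Fin 6) F).det =
      (1 / 144 : F) * ∑ σ : Equiv.Perm (Fin 6),
        ((Equiv.Perm.sign σ : ℤ) : F) *
          (((x (σ 1) - x (σ 0)) * (x (σ 2) - x (σ 1)) * (x (σ 2) - x (σ 0))) *
            ((x (σ 4) - x (σ 3)) * (x (σ 5) - x (σ 4)) * (x (σ 5) - x (σ 3))) *
            ((y (σ 3) - y (σ 0)) * (y (σ 4) - y (σ 1)) * (y (σ 5) - y (σ 2)))) := by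
  have hB := signedSum_vandermonde_mul_vandermonde_separated x y
  have hT := signedSum_vandermonde_mul_vandermonde_mixed x y
  set B : Equiv.Perm (Fin 6) → F := fun σ =>
      (x (σ 1) - x (σ 0)) * (x (σ 2) - x (σ 1)) * (x (σ 2) - x (σ 0)) *
        ((x (σ 4) - x (σ 3)) * (x (σ 5) - x (σ 4)) * (x (σ 5) - x (σ 3)) *
          (y (σ 3) * y (σ 4) * y (σ 5))) with hBdef
  set T : Equiv.Perm (Fin 6) → F := fun σ =>
      (x (σ 1) - x (σ 0)) * (x (σ 2) - x (σ 1)) * (x (σ 2) - x (σ 0)) *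
        ((x (σ 4) - x (σ 3)) * (x (σ 5) - x (σ 4)) * (x (σ 5) - x (σ 3)) *
          (y (σ 2) * y (σ 3) * y (σ 4))) with hTdef
  let b : Equiv.Perm (Fin 6) := Equiv.swap 0 3 * Equiv.swap 1 4 * Equiv.swap 2 5
  let c : Equiv.Perm (Fin 6) :=
    Equiv.swap 0 1 * Equiv.swap 1 2 * (Equiv.swap 3 4 * Equiv.swap 4 5)
  have hb : Equiv.Perm.sign b = -1 := by decide
  have hc : Equiv.Perm.sign c = 1 := by decide
  have key : (fun σ : Equiv.Perm (Fin 6) =>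
      (((x (σ 1) - x (σ 0)) * (x (σ 2) - x (σ 1)) * (x (σ 2) - x (σ 0))) *
        ((x (σ 4) - x (σ 3)) * (x (σ 5) - x (σ 4)) * (x (σ 5) - x (σ 3))) *
        ((y (σ 3) - y (σ 0)) * (y (σ 4) - y (σ 1)) * (y (σ 5) - y (σ 2))))) =
      B - (fun σ => B (σ * b)) - T - (fun σ => T (σ * c)) - (fun σ => T (σ * (c * c))) +
        (fun σ => T (σ * b)) + (fun σ => T (σ * (b * c))) + (fun σ => T (σ * (b * (c * c)))) := by
    have hb' : b 0 = 3 ∧ b 1 = 4 ∧ b 2 = 5 ∧ b 3 = 0 ∧ b 4 = 1 ∧ b 5 = 2 := by decide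
    have hc' : c 0 = 1 ∧ c 1 = 2 ∧ c 2 = 0 ∧ c 3 = 4 ∧ c 4 = 5 ∧ c 5 = 3 := by decide
    ext σ
    simp only [hBdef, hTdef, Pi.add_apply, Pi.sub_apply, Equiv.Perm.mul_apply, hb', hc']
    ring
  have hsum := congrArg (signedSum (Fin 6) F) key
  simp only [map_add, map_sub, signedSum_mul_right, Equiv.Perm.sign_mul, hb, hc, hB, hT] at hsum
  rw [signedSum_apply] at hsum
  rw [hsum]
  change (vandermondeThreeTwo x y).det = _
  push_cast
  ring
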